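/- arXiv:2402.10810 — 8 statements merged into one kernel-verified Lean document; each statement's English description precedes it below -/
import Mathlib

section
/- Let X ⊆ ℝⁿ be a nonempty closed convex set with diameter at most R (i.e. ‖x − y‖₂ ≤ R for all x, y ∈ X) and let G > 0. Let T ≥ 1 and for t = 1, …, T let f_t : ℝⁿ → ℝ, let x_t ∈ X, and let g_t ∈ ℝⁿ with ‖g_t‖₂ ≤ G be a supergradient of f_t at x_t on X, i.e. f_t(y) − f_t(x_t) ≤ ⟨g_t, y − x_t⟩ for all y ∈ X. Suppose the iterates follow the projected subgradient (ascent) method with step sizes η_t = R/(G√t): x_1 ∈ X, and for each t, x_{t+1} ∈ X is the metric projection of x_t + η_t g_t onto X, i.e. ‖x_{t+1} − (x_t + η_t g_t)‖₂ ≤ ‖y − (x_t + η_t g_t)‖₂ for all y ∈ X. Then for every x ∈ X, Σ_{t=1}^T f_t(x) − Σ_{t=1}^T f_t(x_t) ≤ 3·R·G·√T. -/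
open Finset RealInnerProductSpace

/-- The metric projection `v` of `u` onto a convex set `K` is at least as close to every point
of `K` as `u` is. -/
theorem Convex.norm_sub_le_of_forall_norm_sub_le {E : Type*} [NormedAddCommGroup E]
    [InnerProductSpace ℝ E] {K : Set E} (hK : Convex ℝ K) {u v : E} (hv : v ∈ K)
    (hmin : ∀ w ∈ K, ‖v - u‖ ≤ ‖w - u‖) {w : E} (hw : w ∈ K) : ‖v - w‖ ≤ ‖u - w‖ := by
  have : Nonempty K := ⟨⟨v, hv⟩⟩
  have hinf : ‖u - v‖ = ⨅ w : K, ‖u - w‖ := by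
    refine le_antisymm (le_ciInf fun w => ?_) ?_
    · simpa only [norm_sub_rev u] using hmin w w.2
    · exact ciInf_le (f := fun w : K => ‖u - w‖)
        ⟨0, Set.forall_mem_range.2 fun _ => norm_nonneg _⟩ ⟨v, hv⟩
  have hobtuse : ⟪u - v, w - v⟫ ≤ 0 := (norm_eq_iInf_iff_real_inner_le_zero hK hv).1 hinf w hw
  have hexpand := norm_sub_sq_real (u - v) (w - v)
  rw [sub_sub_sub_cancel_right] at hexpand
  rw [norm_sub_rev v w]
  refine le_of_sq_le_sq ?_ (norm_nonneg _)
  nlinarith [sq_nonneg ‖u - v‖]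

/-- One step of the projected gradient method: the gain along the gradient is controlled by the
decrease of the squared distance to the comparator. -/
theorem Convex.two_mul_inner_le_of_projected_step {E : Type*} [NormedAddCommGroup E]
    [InnerProductSpace ℝ E] {K : Set E} (hK : Convex ℝ K) {p q g y : E} {c G : ℝ} (hq : q ∈ K)
    (hmin : ∀ w ∈ K, ‖q - (p + c • g)‖ ≤ ‖w - (p + c • g)‖) (hg : ‖g‖ ≤ G) (hy : y ∈ K) :
    2 * c * ⟪g, y - p⟫ ≤ ‖p - y‖ ^ 2 - ‖q - y‖ ^ 2 + c ^ 2 * G ^ 2 := by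
  have hdist := pow_le_pow_left₀ (norm_nonneg _) (hK.norm_sub_le_of_forall_norm_sub_le hq hmin hy) 2
  have hgsq : c ^ 2 * ‖g‖ ^ 2 ≤ c ^ 2 * G ^ 2 := by gcongr
  have hexpand := norm_add_sq_real (p - y) (c • g)
  rw [sub_add_eq_add_sub, inner_smul_right, real_inner_comm, norm_smul, mul_pow,
    Real.norm_eq_abs, sq_abs, ← neg_sub y p, inner_neg_right, norm_neg, norm_sub_rev y p] at hexpand
  linarith

theorem Real.inv_sqrt_add_one_le (k : ℕ) :
    (√((k + 1 : ℕ) : ℝ))⁻¹ ≤ 2 * (√((k + 1 : ℕ) : ℝ) - √(k : ℝ)) := by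
  have hpos : 0 < √((k + 1 : ℕ) : ℝ) := Real.sqrt_pos.2 (by positivity)
  have hsq : √((k + 1 : ℕ) : ℝ) ^ 2 = k + 1 := by rw [Real.sq_sqrt (by positivity)]; push_cast; ring
  have hsq' : √(k : ℝ) ^ 2 = k := Real.sq_sqrt (by positivity)
  rw [inv_le_iff_one_le_mul₀ hpos]
  nlinarith [sq_nonneg (√((k + 1 : ℕ) : ℝ) - √(k : ℝ))]

/-- **Regret bound for the projected subgradient (ascent) method** (Zinkevich).
`X ⊆ ℝⁿ` is nonempty closed convex with diameter at most `R`, the supergradients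
`g t` of `f t` at `x t` have norm at most `G`, step sizes are `η t = R / (G √t)`,
and `x (t+1)` is the metric projection of `x t + η t • g t` onto `X`.  Then the
regret against any comparator `x ∈ X` is at most `3 R G √T`. -/
theorem projected_subgradient_regret {n : ℕ}
    (X : Set (EuclideanSpace ℝ (Fin n)))
    (hXne : X.Nonempty) (hXclosed : IsClosed X) (hXconvex : Convex ℝ X)
    (R G : ℝ) (hG : 0 < G)
    (hdiam : ∀ x ∈ X, ∀ y ∈ X, ‖x - y‖ ≤ R)
    (T : ℕ) (hT : 1 ≤ T)
    (f : ℕ → EuclideanSpace ℝ (Fin n) → ℝ)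
    (x g : ℕ → EuclideanSpace ℝ (Fin n))
    (η : ℕ → ℝ) (hη : ∀ t, η t = R / (G * Real.sqrt t))
    (hx1 : x 1 ∈ X)
    (hxX : ∀ t ∈ Finset.Icc 1 T, x t ∈ X)
    (hgnorm : ∀ t ∈ Finset.Icc 1 T, ‖g t‖ ≤ G)
    (hsupergrad : ∀ t ∈ Finset.Icc 1 T, ∀ y ∈ X,
      f t y - f t (x t) ≤ ⟪g t, y - x t⟫)
    (hprojX : ∀ t ∈ Finset.Icc 1 T, x (t + 1) ∈ X)
    (hproj : ∀ t ∈ Finset.Icc 1 T, ∀ y ∈ X,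
      ‖x (t + 1) - (x t + η t • g t)‖ ≤ ‖y - (x t + η t • g t)‖) :
    ∀ y ∈ X,
      ∑ t ∈ Finset.Icc 1 T, f t y - ∑ t ∈ Finset.Icc 1 T, f t (x t)
        ≤ 3 * R * G * Real.sqrt T := by
  intro y hy
  have hR : 0 ≤ R := (norm_nonneg _).trans (hdiam y hy y hy)
  have hregret : ∑ t ∈ Finset.Icc 1 T, f t y - ∑ t ∈ Finset.Icc 1 T, f t (x t)
      ≤ ∑ t ∈ Finset.Icc 1 T, ⟪g t, y - x t⟫ := by
    rw [← Finset.sum_sub_distrib]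
    exact Finset.sum_le_sum fun t ht => hsupergrad t ht y hy
  rcases hR.eq_or_lt with rfl | hRpos
  · refine hregret.trans (le_of_eq ?_)
    rw [Finset.sum_eq_zero fun t ht => ?_]
    · simp
    · rw [norm_le_zero_iff.1 (hdiam y hy _ (hxX t ht)), inner_zero_right]
  have hpotential : ∀ k ≤ T, 2 * R * ∑ t ∈ Finset.Icc 1 k, ⟪g t, y - x t⟫
      + G * √(k : ℝ) * ‖x (k + 1) - y‖ ^ 2 ≤ 3 * R ^ 2 * G * √(k : ℝ) := by
    intro k
    induction k with
    | zero => simp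
    | succ k ih =>
      intro hk
      have hmem : k + 1 ∈ Finset.Icc 1 T := Finset.mem_Icc.2 ⟨by lia, hk⟩
      have hstep := hXconvex.two_mul_inner_le_of_projected_step (hprojX _ hmem)
        (hproj _ hmem) (hgnorm _ hmem) hy
      have hdist : ‖x (k + 1) - y‖ ^ 2 ≤ R ^ 2 :=
        pow_le_pow_left₀ (norm_nonneg _) (hdiam _ (hxX _ hmem) y hy) 2
      have hinv := Real.inv_sqrt_add_one_le k
      have hmono : √(k : ℝ) ≤ √((k + 1 : ℕ) : ℝ) := Real.sqrt_le_sqrt (by simp)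
      have hpos : 0 < √((k + 1 : ℕ) : ℝ) := Real.sqrt_pos.2 (by positivity)
      have ih := ih (by lia)
      rw [hη] at hstep
      rw [Finset.sum_Icc_succ_top (by lia)]
      generalize √((k + 1 : ℕ) : ℝ) = a at *
      generalize √(k : ℝ) = b at *
      generalize ⟪g (k + 1), y - x (k + 1)⟫ = i at *
      generalize ‖x (k + 1) - y‖ ^ 2 = d at *
      generalize ‖x (k + 1 + 1) - y‖ ^ 2 = d' at *
      have hscaled : 2 * R * i ≤ G * a * (d - d') + R ^ 2 * G * a⁻¹ := by
        have := mul_le_mul_of_nonneg_left hstep (mul_pos hG hpos).le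
        field_simp at this ⊢
        linarith
      have hgap : G * (a - b) * d ≤ G * (a - b) * R ^ 2 :=
        mul_le_mul_of_nonneg_left hdist (mul_nonneg hG.le (sub_nonneg.2 hmono))
      have hinv' := mul_le_mul_of_nonneg_left hinv (by positivity : 0 ≤ R ^ 2 * G)
      linarith
  have hfinal := hpotential T le_rfl
  have hdrop : 0 ≤ G * √(T : ℝ) * ‖x (T + 1) - y‖ ^ 2 := by positivity
  have hslack : 0 ≤ R * (R * G * √(T : ℝ)) := by positivity
  refine hregret.trans (le_of_mul_le_mul_left ?_ (by positivity : 0 < 2 * R))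
  linarith
end

section
/- Let X ⊆ ℝⁿ, f : ℝⁿ → ℝ, g : ℝⁿ → ℝᵐ, A an p×n real matrix, b ∈ ℝᵖ, and f_opt ∈ ℝ. Let λ* ∈ ℝᵐ with λ* ≥ 0 componentwise, and assume the sensitivity inequality: for every u ∈ ℝᵐ with u ≥ 0 componentwise and every x ∈ X with g(x) ≤ u componentwise and Ax + b = 0, one has f(x) + ⟨λ*, u⟩ ≥ f_opt. Let ρ > 0 with 2‖λ*‖₁ ≤ ρ, let δ ∈ ℝ, and let x̃ ∈ X satisfy A x̃ + b = 0 and f(x̃) − f_opt + ρ‖[g(x̃)]₊‖_∞ ≤ δ, where [u]₊ denotes the componentwise positive part and ‖·‖_∞ the max-norm on ℝᵐ. Then ‖[g(x̃)]₊‖_∞ ≤ 2δ/ρ. -/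
open Finset

/-- **Constraint violation bound (Theorem 18).**
If the sensitivity inequality `f x + ⟨λ*, u⟩ ≥ f_opt` holds for all feasible
perturbations `u ≥ 0`, `2‖λ*‖₁ ≤ ρ`, and `x̃` is equality-feasible with penalized
suboptimality `f x̃ - f_opt + ρ ‖[g x̃]₊‖_∞ ≤ δ`, then `‖[g x̃]₊‖_∞ ≤ 2δ/ρ`.
Here the sup-norm on `Fin m → ℝ` is the default (Pi) norm `‖·‖`. -/
theorem constraint_violation_bound {n m p : ℕ}
    (X : Set (Fin n → ℝ)) (f : (Fin n → ℝ) → ℝ) (g : (Fin n → ℝ) → Fin m → ℝ)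
    (A : Matrix (Fin p) (Fin n) ℝ) (b : Fin p → ℝ) (fopt : ℝ)
    (lam : Fin m → ℝ) (hlam : ∀ j, 0 ≤ lam j)
    (hsens : ∀ u : Fin m → ℝ, (∀ j, 0 ≤ u j) →
      ∀ x ∈ X, (∀ j, g x j ≤ u j) → A.mulVec x + b = 0 →
        fopt ≤ f x + ∑ j, lam j * u j)
    (ρ δ : ℝ) (hρ : 0 < ρ) (hl1 : 2 * ∑ j, |lam j| ≤ ρ)
    (xt : Fin n → ℝ) (hxt : xt ∈ X) (hAxt : A.mulVec xt + b = 0)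
    (hsubopt : f xt - fopt + ρ * ‖fun j => max (g xt j) 0‖ ≤ δ) :
    ‖fun j => max (g xt j) 0‖ ≤ 2 * δ / ρ := by
  have hs := hsens (fun j => max (g xt j) 0) (fun j => le_max_right _ _) xt hxt
    (fun j => le_max_left _ _) hAxt
  have hholder : ∑ j, lam j * max (g xt j) 0 ≤
      (∑ j, |lam j|) * ‖fun j => max (g xt j) 0‖ := by
    rw [Finset.sum_mul]
    refine Finset.sum_le_sum fun j _ => ?_
    exact mul_le_mul (le_abs_self _)
      ((le_abs_self _).trans (norm_le_pi_norm (fun j => max (g xt j) 0) j))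
      (le_max_right _ _) (abs_nonneg _)
  have hscale := mul_le_mul_of_nonneg_right hl1 (norm_nonneg fun j => max (g xt j) 0)
  rw [le_div_iff₀ hρ]
  linarith
end

section
/- Let X ⊆ ℝⁿ, f : ℝⁿ → ℝ, g : ℝⁿ → ℝᵐ, A a p×n real matrix, b ∈ ℝᵖ. Suppose x̄ ∈ X satisfies g_j(x̄) < 0 for every j ∈ {1,…,m} and A x̄ + b = 0. Let λ ∈ ℝᵐ with λ ≥ 0 componentwise, γ ∈ ℝᵖ, and M ∈ ℝ be such that the dual function value is at least M: f(x) + ⟨λ, g(x)⟩ + ⟨γ, Ax + b⟩ ≥ M for all x ∈ X. Then ‖λ‖₁ ≤ ( f(x̄) − M ) / min_{j ∈ {1,…,m}} ( −g_j(x̄) ). -/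
open Finset

/-- **ℓ₁-bound on dual variables with lower-bounded dual value (Theorem 19).**
Given a strict Slater point `x̄` (`g_j x̄ < 0` for all `j`, `A x̄ + b = 0`) and a
dual pair `(λ, γ)` with dual function value at least `M`
(`f x + ⟨λ, g x⟩ + ⟨γ, A x + b⟩ ≥ M` for all `x ∈ X`), one has
`‖λ‖₁ ≤ (f x̄ - M) / min_j (-g_j x̄)`. -/
theorem dual_l1_bound {n m p : ℕ} [NeZero m]
    (X : Set (Fin n → ℝ)) (f : (Fin n → ℝ) → ℝ) (g : (Fin n → ℝ) → Fin m → ℝ)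
    (A : Matrix (Fin p) (Fin n) ℝ) (b : Fin p → ℝ)
    (xb : Fin n → ℝ) (hxbX : xb ∈ X)
    (hslater : ∀ j, g xb j < 0) (hxbeq : A.mulVec xb + b = 0)
    (lam : Fin m → ℝ) (hlam : ∀ j, 0 ≤ lam j) (γ : Fin p → ℝ) (M : ℝ)
    (hdual : ∀ x ∈ X,
      M ≤ f x + (∑ j, lam j * g x j) + ∑ i, γ i * (A.mulVec x + b) i) :
    ∑ j, |lam j| ≤ (f xb - M) /
      Finset.univ.inf' Finset.univ_nonempty (fun j => -g xb j) := by
  have hpos : 0 < Finset.univ.inf' Finset.univ_nonempty (fun j => -g xb j) :=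
    (Finset.lt_inf'_iff _).2 fun j _ => neg_pos.2 (hslater j)
  have hM := hdual xb hxbX
  simp only [hxbeq, Pi.zero_apply, mul_zero, Finset.sum_const_zero, add_zero] at hM
  rw [le_div_iff₀ hpos, Finset.sum_mul]
  calc ∑ j, |lam j| * Finset.univ.inf' Finset.univ_nonempty (fun j => -g xb j)
      ≤ ∑ j, -(lam j * g xb j) := Finset.sum_le_sum fun j _ => by
        rw [abs_of_nonneg (hlam j), ← mul_neg]
        exact mul_le_mul_of_nonneg_left
          (Finset.inf'_le (fun j => -g xb j) (Finset.mem_univ j)) (hlam j)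
    _ ≤ f xb - M := by
        rw [Finset.sum_neg_distrib]
        linarith
end

section
/- Let X ⊆ ℝⁿ, f : ℝⁿ → ℝ, g : ℝⁿ → ℝᵐ, A a p×n real matrix, b ∈ ℝᵖ, and let f_opt ∈ ℝ be the optimal value of the primal problem, i.e. f_opt = inf{ f(x) : x ∈ X, g(x) ≤ 0 componentwise, Ax + b = 0 } (assumed finite and attained on a nonempty feasible set). Suppose x̄ ∈ X satisfies g_j(x̄) < 0 for every j and A x̄ + b = 0. If λ* ∈ ℝᵐ with λ* ≥ 0 componentwise and γ* ∈ ℝᵖ form an optimal dual solution in the sense that f(x) + ⟨λ*, g(x)⟩ + ⟨γ*, Ax + b⟩ ≥ f_opt for all x ∈ X, then ‖λ*‖₁ ≤ ( f(x̄) − f_opt ) / min_{j ∈ {1,…,m}} ( −g_j(x̄) ). -/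
open Finset

/-- **ℓ₁-bound on an optimal dual solution (Corollary 20).**
`f_opt` is the (finite, attained) optimal value of
`min { f x : x ∈ X, g x ≤ 0, A x + b = 0 }`, `x̄` is a strict Slater point, and
`(λ*, γ*)` is an optimal dual solution in the strong-duality sense
`f x + ⟨λ*, g x⟩ + ⟨γ*, A x + b⟩ ≥ f_opt` for all `x ∈ X`.  Then
`‖λ*‖₁ ≤ (f x̄ - f_opt) / min_j (-g_j x̄)`. -/
theorem optimal_dual_l1_bound {n m p : ℕ} [NeZero m]
    (X : Set (Fin n → ℝ)) (f : (Fin n → ℝ) → ℝ) (g : (Fin n → ℝ) → Fin m → ℝ)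
    (A : Matrix (Fin p) (Fin n) ℝ) (b : Fin p → ℝ) (fopt : ℝ)
    (hattained : ∃ x ∈ X, (∀ j, g x j ≤ 0) ∧ A.mulVec x + b = 0 ∧ f x = fopt)
    (hopt : ∀ x ∈ X, (∀ j, g x j ≤ 0) → A.mulVec x + b = 0 → fopt ≤ f x)
    (xb : Fin n → ℝ) (hxbX : xb ∈ X)
    (hslater : ∀ j, g xb j < 0) (hxbeq : A.mulVec xb + b = 0)
    (lam : Fin m → ℝ) (hlam : ∀ j, 0 ≤ lam j) (γ : Fin p → ℝ)
    (hdual : ∀ x ∈ X,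
      fopt ≤ f x + (∑ j, lam j * g x j) + ∑ i, γ i * (A.mulVec x + b) i) :
    ∑ j, |lam j| ≤ (f xb - fopt) /
      Finset.univ.inf' Finset.univ_nonempty (fun j => -g xb j) := by
  have hpos : 0 < Finset.univ.inf' Finset.univ_nonempty (fun j => -g xb j) := by
    rw [Finset.lt_inf'_iff]
    exact fun j _ => neg_pos.mpr (hslater j)
  have hd := hdual xb hxbX
  simp only [hxbeq, Pi.zero_apply, mul_zero, Finset.sum_const_zero, add_zero] at hd
  rw [le_div_iff₀ hpos, Finset.sum_mul]
  calc ∑ j, |lam j| * Finset.univ.inf' Finset.univ_nonempty (fun j => -g xb j)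
      ≤ ∑ j, -(lam j * g xb j) := by
        refine Finset.sum_le_sum fun j _ => ?_
        rw [abs_of_nonneg (hlam j), ← mul_neg]
        exact mul_le_mul_of_nonneg_left
          (Finset.inf'_le (fun j => -g xb j) (Finset.mem_univ j)) (hlam j)
    _ ≤ f xb - fopt := by
        rw [Finset.sum_neg_distrib]
        linarith
end

section
/- Let λ₀ ≥ 1 and let M_0 = λ₀ I be the d×d real matrix λ₀ times the identity. For t = 1, …, T let G_t be a d×d real positive semidefinite matrix whose eigenvalues are at most 1 (equivalently, I − G_t is positive semidefinite), and set M_t = M_{t−1} + G_t. Then 2 ln det(M_T) − 2 ln det(λ₀ I) ≥ Σ_{t=1}^T Tr( G_t M_{t−1}^{-1} ). -/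
open Finset Matrix

/-- On `[0, 1]` the logarithm of `1 + x` dominates `x / 2`. -/
lemma le_two_mul_log_one_add {x : ℝ} (h0 : 0 ≤ x) (h1 : x ≤ 1) :
    x ≤ 2 * Real.log (1 + x) := by
  have hpos : 0 < 1 + x := by linarith
  have hlog := Real.one_sub_inv_le_log_of_pos hpos
  have hx : x / 2 ≤ 1 - (1 + x)⁻¹ := by
    field_simp
    nlinarith
  linarith

section

variable {n : Type*} [Fintype n] [DecidableEq n]

lemma Matrix.IsHermitian.eigenvalues_le_one_of_posSemidef_one_sub {A : Matrix n n ℝ}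
    (hA : A.IsHermitian) (h : (1 - A).PosSemidef) (i : n) : hA.eigenvalues i ≤ 1 := by
  have hv := h.dotProduct_mulVec_nonneg (hA.eigenvectorBasis i)
  have hnorm : star (hA.eigenvectorBasis i).ofLp ⬝ᵥ (hA.eigenvectorBasis i).ofLp = 1 := by
    have := EuclideanSpace.inner_eq_star_dotProduct (𝕜 := ℝ)
      (hA.eigenvectorBasis i) (hA.eigenvectorBasis i)
    rw [dotProduct_comm, ← this]
    simp
  rw [sub_mulVec, one_mulVec, hA.mulVec_eigenvectorBasis, dotProduct_sub, dotProduct_smul,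
    hnorm] at hv
  simpa using hv

lemma Matrix.IsHermitian.det_one_add_eq_prod_eigenvalues {A : Matrix n n ℝ}
    (hA : A.IsHermitian) : (1 + A).det = ∏ i, (1 + hA.eigenvalues i) := by
  have h := congrArg (Polynomial.eval (-1)) hA.charpoly_eq
  rw [eval_charpoly, Polynomial.eval_prod] at h
  have hneg : scalar n (-1 : ℝ) - A = -(1 + A) := by
    rw [map_neg, map_one]
    abel
  have hprod : ∏ i, Polynomial.eval (-1) (Polynomial.X - Polynomial.C (hA.eigenvalues i)) =
      (-1) ^ Fintype.card n * ∏ i, (1 + hA.eigenvalues i) := by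
    rw [← Finset.card_univ, ← Finset.prod_const, ← Finset.prod_mul_distrib]
    refine Finset.prod_congr rfl fun i _ => ?_
    simp only [Polynomial.eval_sub, Polynomial.eval_X, Polynomial.eval_C]
    ring
  rw [hneg, det_neg] at h
  exact mul_left_cancel₀ (pow_ne_zero _ (by norm_num)) (h.trans hprod)

lemma Matrix.PosSemidef.trace_le_two_mul_log_det_one_add {A : Matrix n n ℝ}
    (hA : A.PosSemidef) (h : (1 - A).PosSemidef) :
    A.trace ≤ 2 * Real.log (1 + A).det := by
  rw [hA.1.trace_eq_sum_eigenvalues, hA.1.det_one_add_eq_prod_eigenvalues,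
    Real.log_prod fun i _ => by linarith [hA.eigenvalues_nonneg i], Finset.mul_sum]
  exact Finset.sum_le_sum fun i _ => le_two_mul_log_one_add (hA.eigenvalues_nonneg i)
    (hA.1.eigenvalues_le_one_of_posSemidef_one_sub h i)

open scoped MatrixOrder in
lemma Matrix.PosDef.exists_isUnit_eq_conjTranspose_mul_self {M : Matrix n n ℝ}
    (hM : M.PosDef) : ∃ S : Matrix n n ℝ, IsUnit S.det ∧ M = Sᴴ * S := by
  obtain ⟨S, hS⟩ := CStarAlgebra.nonneg_iff_eq_star_mul_self.mp hM.posSemidef.nonneg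
  refine ⟨S, ?_, hS⟩
  have hdet := hM.det_pos.ne'
  rw [hS, det_mul] at hdet
  exact (right_ne_zero_of_mul hdet).isUnit

/-- One-step potential inequality: adding `0 ≤ G ≤ M` to `M`. -/
lemma Matrix.PosDef.trace_mul_inv_le_log_det_add {M G : Matrix n n ℝ}
    (hM : M.PosDef) (hG : G.PosSemidef) (hle : (M - G).PosSemidef) :
    (G * M⁻¹).trace ≤ 2 * Real.log (M + G).det - 2 * Real.log M.det := by
  obtain ⟨S, hS, rfl⟩ := hM.exists_isUnit_eq_conjTranspose_mul_self
  have hS' : IsUnit Sᴴ.det := by rwa [det_conjTranspose, isUnit_star]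
  set A := (S⁻¹)ᴴ * G * S⁻¹ with hAdef
  have hcancel : (S⁻¹)ᴴ * (Sᴴ * S) * S⁻¹ = 1 := by
    rw [conjTranspose_nonsing_inv, nonsing_inv_mul_cancel_left _ _ hS', mul_nonsing_inv _ hS]
  have hA : A.PosSemidef := hG.conjTranspose_mul_mul_same _
  have hA1 : (1 - A).PosSemidef := by
    have := hle.conjTranspose_mul_mul_same S⁻¹
    rwa [mul_sub, sub_mul, hcancel] at this
  have htrace : (G * (Sᴴ * S)⁻¹).trace = A.trace := by
    rw [mul_inv_rev, hAdef, trace_mul_cycle', ← conjTranspose_nonsing_inv, mul_assoc]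
  have hadd : Sᴴ * S + G = Sᴴ * (1 + A) * S := by
    rw [mul_add, add_mul, mul_one, hAdef, conjTranspose_nonsing_inv, ← mul_assoc,
      mul_nonsing_inv_cancel_left _ _ hS', nonsing_inv_mul_cancel_right _ _ hS]
  have hdet : (Sᴴ * S + G).det = (Sᴴ * S).det * (1 + A).det := by
    rw [hadd, det_mul, det_mul, det_mul]
    ring
  have hpos : 0 < (1 + A).det := (PosDef.one.add_posSemidef hA).det_pos
  rw [htrace, hdet, Real.log_mul hM.det_pos.ne' hpos.ne']
  linarith [hA.trace_le_two_mul_log_det_one_add hA1]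

end

/-- **Matrix potential lemma (Lemma 26).**
Starting from `M 0 = λ₀ • I` with `λ₀ ≥ 1` and adding positive semidefinite
increments `G t` with eigenvalues at most `1` (i.e. `I - G t` is positive
semidefinite), the sum of the traces `Tr (G t * M (t-1)⁻¹)` is bounded by
`2 ln det (M T) - 2 ln det (λ₀ • I)`. -/
theorem matrix_potential_lemma {d : ℕ} (T : ℕ) (lam0 : ℝ) (hlam0 : 1 ≤ lam0)
    (G M : ℕ → Matrix (Fin d) (Fin d) ℝ)
    (hM0 : M 0 = lam0 • (1 : Matrix (Fin d) (Fin d) ℝ))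
    (hGpsd : ∀ t ∈ Finset.Icc 1 T, (G t).PosSemidef)
    (hGle : ∀ t ∈ Finset.Icc 1 T, ((1 : Matrix (Fin d) (Fin d) ℝ) - G t).PosSemidef)
    (hMrec : ∀ t ∈ Finset.Icc 1 T, M t = M (t - 1) + G t) :
    ∑ t ∈ Finset.Icc 1 T, (G t * (M (t - 1))⁻¹).trace
      ≤ 2 * Real.log (M T).det
        - 2 * Real.log (lam0 • (1 : Matrix (Fin d) (Fin d) ℝ)).det := by
  suffices h : (M T - 1).PosSemidef ∧ ∑ t ∈ Finset.Icc 1 T, (G t * (M (t - 1))⁻¹).trace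
      ≤ 2 * Real.log (M T).det - 2 * Real.log (M 0).det by
    rw [← hM0]
    exact h.2
  induction T with
  | zero =>
    refine ⟨?_, by simp⟩
    have h : M 0 - 1 = (lam0 - 1) • (1 : Matrix (Fin d) (Fin d) ℝ) := by
      rw [hM0, sub_smul, one_smul]
    rw [h]
    exact PosSemidef.one.smul (sub_nonneg.mpr hlam0)
  | succ k ih =>
    have hsub := Finset.Icc_subset_Icc_right (a := 1) k.le_succ
    obtain ⟨hM, hsum⟩ := ih (fun t ht => hGpsd t (hsub ht)) (fun t ht => hGle t (hsub ht))
      (fun t ht => hMrec t (hsub ht))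
    have hmem : k + 1 ∈ Finset.Icc 1 (k + 1) := by simp
    have hrec : M (k + 1) = M k + G (k + 1) := hMrec _ hmem
    have hG := hGpsd _ hmem
    have hpd : (M k).PosDef := by simpa using PosDef.one.add_posSemidef hM
    have hle : (M k - G (k + 1)).PosSemidef := by simpa using hM.add (hGle _ hmem)
    have hstep := hpd.trace_mul_inv_le_log_det_add hG hle
    rw [← hrec] at hstep
    refine ⟨by simpa [hrec, add_sub_right_comm] using hM.add hG, ?_⟩
    rw [Finset.sum_Icc_succ_top (by lia), Nat.add_sub_cancel]
    linarith
end

section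
/- Let X_1, …, X_n be random variables with 0 ≤ X_i ≤ 1 almost surely, on a probability space, and write E[· | X_1, …, X_{k−1}] for conditional expectation given the σ-algebra generated by X_1, …, X_{k−1}. Let S_n = Σ_{i=1}^n X_i and K_n = Σ_{k=1}^n E[X_k² | X_1, …, X_{k−1}]. Then for all ε ≥ 0 and k ≥ 0: P( Σ_{i=1}^n E[X_i | X_1, …, X_{i−1}] − S_n ≥ ε and K_n ≤ k ) ≤ exp( −ε² / (2k + 2ε/3) ). -/
open MeasureTheory Finset

theorem Real.exp_neg_le_one_sub_add_sq_div_two {y : ℝ} (hy : 0 ≤ y) :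
    Real.exp (-y) ≤ 1 - y + y ^ 2 / 2 := by
  have h := Real.quadratic_le_exp_of_nonneg hy
  have hpos : 0 < 1 - y + y ^ 2 / 2 := by nlinarith [sq_nonneg (y - 1)]
  rw [Real.exp_neg, inv_le_iff_one_le_mul₀ (Real.exp_pos y)]
  nlinarith [mul_le_mul_of_nonneg_left h hpos.le, sq_nonneg (y ^ 2)]

theorem ae_sq_mem_unitInterval {Ω : Type*} {m0 : MeasurableSpace Ω} {P : Measure Ω}
    {X : Ω → ℝ} (hbdd : ∀ᵐ ω ∂P, 0 ≤ X ω ∧ X ω ≤ 1) :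
    ∀ᵐ ω ∂P, 0 ≤ X ω ^ 2 ∧ X ω ^ 2 ≤ 1 :=
  hbdd.mono fun _ h => ⟨sq_nonneg _, pow_le_one₀ h.1 h.2⟩

section

variable {Ω : Type*} {m m0 : MeasurableSpace Ω} {P : Measure Ω} [IsProbabilityMeasure P]
  {X : Ω → ℝ} {l : ℝ}

theorem integrable_of_ae_mem_unitInterval (hX : Measurable X)
    (hbdd : ∀ᵐ ω ∂P, 0 ≤ X ω ∧ X ω ≤ 1) : Integrable X P := by
  refine Integrable.of_bound hX.aestronglyMeasurable 1 ?_
  filter_upwards [hbdd] with ω h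
  rw [Real.norm_of_nonneg h.1]
  exact h.2

theorem condExp_mem_unitInterval (hm : m ≤ m0) (hX : Measurable X)
    (hbdd : ∀ᵐ ω ∂P, 0 ≤ X ω ∧ X ω ≤ 1) :
    ∀ᵐ ω ∂P, 0 ≤ (P[X | m]) ω ∧ (P[X | m]) ω ≤ 1 := by
  have h1 : P[X | m] ≤ᵐ[P] P[fun _ => (1 : ℝ) | m] :=
    condExp_mono (integrable_of_ae_mem_unitInterval hX hbdd) (integrable_const _)
      (hbdd.mono fun ω h => h.2)
  rw [condExp_const hm] at h1
  have h0 : 0 ≤ᵐ[P] P[X | m] := condExp_nonneg (hbdd.mono fun ω h => h.1)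
  filter_upwards [h0, h1] with ω a b using ⟨a, b⟩

theorem integrable_exp_neg_mul (hl : 0 ≤ l) (hX : Measurable X)
    (hbdd : ∀ᵐ ω ∂P, 0 ≤ X ω ∧ X ω ≤ 1) :
    Integrable (fun ω => Real.exp (-(l * X ω))) P := by
  refine Integrable.of_bound (by fun_prop) 1 ?_
  filter_upwards [hbdd] with ω h
  rw [Real.norm_of_nonneg (Real.exp_pos _).le, Real.exp_le_one_iff]
  linarith [mul_nonneg hl h.1]

/-- A conditional Laplace transform bound for variables in `[0, 1]`. -/
theorem condExp_exp_neg_mul_le (hm : m ≤ m0) (hl : 0 ≤ l) (hX : Measurable X)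
    (hbdd : ∀ᵐ ω ∂P, 0 ≤ X ω ∧ X ω ≤ 1) :
    ∀ᵐ ω ∂P, (P[fun ω' => Real.exp (-(l * X ω')) | m]) ω ≤
      Real.exp (-(l * (P[X | m]) ω - l ^ 2 / 2 * (P[fun ω' => X ω' ^ 2 | m]) ω)) := by
  have hXi := integrable_of_ae_mem_unitInterval hX hbdd
  have hX2i := integrable_of_ae_mem_unitInterval (hX.pow_const 2) (ae_sq_mem_unitInterval hbdd)
  have hlin : Integrable ((fun _ => (1 : ℝ)) - l • X) P := (integrable_const _).sub (hXi.smul l)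
  have hquad : Integrable ((l ^ 2 / 2) • fun ω => X ω ^ 2) P := hX2i.smul (l ^ 2 / 2)
  have hle : P[fun ω' => Real.exp (-(l * X ω')) | m] ≤ᵐ[P]
      P[((fun _ => (1 : ℝ)) - l • X) + (l ^ 2 / 2) • fun ω => X ω ^ 2 | m] := by
    refine condExp_mono (integrable_exp_neg_mul hl hX hbdd) (hlin.add hquad) ?_
    filter_upwards [hbdd] with ω h
    have := Real.exp_neg_le_one_sub_add_sq_div_two (mul_nonneg hl h.1)
    simp only [Pi.add_apply, Pi.sub_apply, Pi.smul_apply, smul_eq_mul]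
    linarith [mul_pow l (X ω) 2]
  filter_upwards [hle, condExp_add hlin hquad m,
    condExp_sub (integrable_const (1 : ℝ)) (hXi.smul l) m, condExp_smul l X m (μ := P),
    condExp_smul (l ^ 2 / 2) (fun ω => X ω ^ 2) m (μ := P)] with ω h1 h2 h3 h4 h5
  rw [h2, Pi.add_apply, h3, Pi.sub_apply, h4, h5, condExp_const hm] at h1
  simp only [Pi.smul_apply, smul_eq_mul] at h1
  refine h1.trans (le_trans (le_of_eq ?_) (Real.add_one_le_exp _))
  ring

/-- Multiplying a bounded `m`-measurable weight by the exponential Freedman increment does not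
increase its integral. -/
theorem integral_mul_exp_compensated_le (hm : m ≤ m0) (hl : 0 ≤ l) (hX : Measurable X)
    (hbdd : ∀ᵐ ω ∂P, 0 ≤ X ω ∧ X ω ≤ 1) {M : Ω → ℝ} (hM : StronglyMeasurable[m] M)
    (hM0 : ∀ ω, 0 ≤ M ω) {C : ℝ} (hMC : ∀ᵐ ω ∂P, M ω ≤ C) :
    (∀ᵐ ω ∂P, M ω * Real.exp (l * ((P[X | m]) ω - X ω)
        - l ^ 2 / 2 * (P[fun ω' => X ω' ^ 2 | m]) ω) ≤ C * Real.exp l) ∧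
    ∫ ω, M ω * Real.exp (l * ((P[X | m]) ω - X ω)
        - l ^ 2 / 2 * (P[fun ω' => X ω' ^ 2 | m]) ω) ∂P ≤ ∫ ω, M ω ∂P := by
  set A := P[X | m]
  set B := P[fun ω' => X ω' ^ 2 | m]
  have hA : StronglyMeasurable[m] A := stronglyMeasurable_condExp
  have hB : StronglyMeasurable[m] B := stronglyMeasurable_condExp
  set W : Ω → ℝ := fun ω => M ω * Real.exp (l * A ω - l ^ 2 / 2 * B ω)
  set E : Ω → ℝ := fun ω => Real.exp (-(l * X ω))
  have hW : StronglyMeasurable[m] W :=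
    hM.mul (Real.continuous_exp.comp_stronglyMeasurable
      ((hA.const_mul l).sub (hB.const_mul (l ^ 2 / 2))))
  have hWE : (fun ω => M ω * Real.exp (l * (A ω - X ω) - l ^ 2 / 2 * B ω)) = W * E := by
    ext ω
    simp only [W, E, Pi.mul_apply, mul_assoc, ← Real.exp_add]
    ring_nf
  have hW0 : ∀ ω, 0 ≤ W ω := fun ω => mul_nonneg (hM0 ω) (Real.exp_pos _).le
  have hEint : Integrable E P := integrable_exp_neg_mul hl hX hbdd
  have hbound : ∀ᵐ ω ∂P, (W * E) ω ≤ C * Real.exp l := by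
    filter_upwards [hbdd, hMC, condExp_mem_unitInterval hm hX hbdd,
      condExp_mem_unitInterval hm (hX.pow_const 2) (ae_sq_mem_unitInterval hbdd)]
      with ω h hC hAω hBω
    rw [← congrFun hWE ω]
    refine mul_le_mul hC (Real.exp_le_exp.2 ?_) (Real.exp_pos _).le ((hM0 ω).trans hC)
    have h1 : 0 ≤ l ^ 2 / 2 * B ω := mul_nonneg (by positivity) hBω.1
    have h2 : l * (A ω - X ω) ≤ l * 1 :=
      mul_le_mul_of_nonneg_left (by linarith [hAω.2, h.1]) hl
    linarith
  have hWEint : Integrable (W * E) P := by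
    refine Integrable.of_bound
      ((hW.mono hm).aestronglyMeasurable.mul hEint.aestronglyMeasurable) (C * Real.exp l) ?_
    filter_upwards [hbound] with ω h
    have h0 : 0 ≤ (W * E) ω := mul_nonneg (hW0 ω) (Real.exp_pos _).le
    rwa [Real.norm_of_nonneg h0]
  have hMint : Integrable M P := by
    refine Integrable.of_bound (hM.mono hm).aestronglyMeasurable C ?_
    filter_upwards [hMC] with ω h
    rwa [Real.norm_of_nonneg (hM0 ω)]
  refine ⟨(congrArg (fun f : Ω → ℝ => ∀ᵐ ω ∂P, f ω ≤ C * Real.exp l) hWE).mpr hbound, ?_⟩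
  rw [hWE, ← integral_condExp hm]
  refine integral_mono_ae integrable_condExp hMint ?_
  filter_upwards [condExp_mul_of_stronglyMeasurable_left hW hWEint hEint,
    condExp_exp_neg_mul_le hm hl hX hbdd] with ω h1 h2
  rw [h1, Pi.mul_apply]
  refine (mul_le_mul_of_nonneg_left h2 (hW0 ω)).trans (le_of_eq ?_)
  simp only [W, A, B]
  rw [mul_assoc, ← Real.exp_add, add_neg_cancel, Real.exp_zero, mul_one]

end

/-- The exponential process attached to a sequence of variables in `[0, 1]` adapted to `𝒢` is
adapted, bounded, and has integral at most one. -/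
theorem exp_sum_compensated_integral_le_one
    {Ω : Type*} {m0 : MeasurableSpace Ω} {P : Measure Ω} [IsProbabilityMeasure P]
    {n : ℕ} {X : ℕ → Ω → ℝ} {𝒢 : ℕ → MeasurableSpace Ω} {l : ℝ} (hl : 0 ≤ l)
    (hXmeas : ∀ i, Measurable (X i))
    (hXbdd : ∀ i ∈ Finset.Icc 1 n, ∀ᵐ ω ∂P, 0 ≤ X i ω ∧ X i ω ≤ 1)
    (hle : ∀ j, 𝒢 j ≤ m0) (hmono : Monotone 𝒢) (hadapt : ∀ i, 1 ≤ i → Measurable[𝒢 i] (X i))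
    (j : ℕ) (hj : j ≤ n) :
    let M : Ω → ℝ := fun ω => Real.exp (∑ i ∈ Finset.Icc 1 j,
      (l * ((P[X i | 𝒢 (i - 1)]) ω - X i ω)
        - l ^ 2 / 2 * (P[fun ω' => X i ω' ^ 2 | 𝒢 (i - 1)]) ω))
    StronglyMeasurable[𝒢 j] M ∧ (∃ C, ∀ᵐ ω ∂P, M ω ≤ C) ∧ ∫ ω, M ω ∂P ≤ 1 := by
  induction j with
  | zero => simpa using ⟨stronglyMeasurable_const, ⟨1, le_rfl⟩⟩
  | succ j ih =>
    obtain ⟨hM, ⟨C, hC⟩, hint⟩ := ih (by omega)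
    have hstep := integral_mul_exp_compensated_le (hle j) hl (hXmeas (j + 1))
      (hXbdd (j + 1) (by simp; omega)) hM (fun ω => (Real.exp_pos _).le) hC
    simp only [Finset.sum_Icc_succ_top (Nat.le_add_left 1 j), Real.exp_add, add_tsub_cancel_right]
    refine ⟨?_, ⟨_, hstep.1⟩, hstep.2.trans hint⟩
    have hj' : 𝒢 j ≤ 𝒢 (j + 1) := hmono j.le_succ
    have hA : StronglyMeasurable[𝒢 (j + 1)] (P[X (j + 1) | 𝒢 j]) :=
      stronglyMeasurable_condExp.mono hj'
    have hB : StronglyMeasurable[𝒢 (j + 1)] (P[fun ω' => X (j + 1) ω' ^ 2 | 𝒢 j]) :=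
      stronglyMeasurable_condExp.mono hj'
    exact (hM.mono hj').mul (Real.continuous_exp.comp_stronglyMeasurable
      (((hA.sub (hadapt (j + 1) (by omega)).stronglyMeasurable).const_mul l).sub
        (hB.const_mul (l ^ 2 / 2))))

theorem freedman_exponent_le {ε k : ℝ} (hε : 0 ≤ ε) (hk : 0 ≤ k) :
    -(ε / (k + ε / 3) * ε - (ε / (k + ε / 3)) ^ 2 / 2 * k) ≤
      -ε ^ 2 / (2 * k + 2 * ε / 3) := by
  rcases hε.eq_or_lt with rfl | hε'
  · simp
  have hD : 0 < k + ε / 3 := by positivity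
  have h2 : 2 * k + 2 * ε / 3 = 2 * (k + ε / 3) := by ring
  rw [h2, ← sub_nonneg]
  have : -ε ^ 2 / (2 * (k + ε / 3)) -
      -(ε / (k + ε / 3) * ε - (ε / (k + ε / 3)) ^ 2 / 2 * k) =
      ε ^ 3 / (6 * (k + ε / 3) ^ 2) := by
    field_simp
    ring
  rw [this]
  positivity

/-- **Freedman's inequality (Lemma 29).**
For random variables `X_1, …, X_n` with `0 ≤ X_i ≤ 1`, writing
`𝒢 k = σ(X_1, …, X_k)` for the natural filtration,
`S_n = ∑ X_i`, and `K_n = ∑_k E[X_k² | 𝒢 (k-1)]`, for all `ε, k ≥ 0`: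
`P( ∑_i E[X_i | 𝒢 (i-1)] - S_n ≥ ε and K_n ≤ k ) ≤ exp (-ε² / (2k + 2ε/3))`. -/
theorem freedman_inequality
    {Ω : Type*} {m0 : MeasurableSpace Ω} (P : Measure Ω) [IsProbabilityMeasure P]
    (n : ℕ) (X : ℕ → Ω → ℝ)
    (hXmeas : ∀ i, Measurable (X i))
    (hXbdd : ∀ i ∈ Finset.Icc 1 n, ∀ᵐ ω ∂P, 0 ≤ X i ω ∧ X i ω ≤ 1)
    (𝒢 : ℕ → MeasurableSpace Ω)
    (h𝒢 : ∀ j, 𝒢 j = ⨆ i ∈ Finset.Icc 1 j, MeasurableSpace.comap (X i) inferInstance)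
    (ε k : ℝ) (hε : 0 ≤ ε) (hk : 0 ≤ k) :
    P {ω | ε ≤ (∑ i ∈ Finset.Icc 1 n, (P[X i | 𝒢 (i - 1)]) ω)
              - ∑ i ∈ Finset.Icc 1 n, X i ω
          ∧ (∑ i ∈ Finset.Icc 1 n, (P[fun ω' => X i ω' ^ 2 | 𝒢 (i - 1)]) ω) ≤ k}
      ≤ ENNReal.ofReal (Real.exp (-ε ^ 2 / (2 * k + 2 * ε / 3))) := by
  set l := ε / (k + ε / 3)
  have hl : 0 ≤ l := by positivity
  have hle : ∀ j, 𝒢 j ≤ m0 := fun j => by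
    rw [h𝒢]
    exact iSup₂_le fun i _ => (hXmeas i).comap_le
  have hmono : Monotone 𝒢 := fun a b hab => by
    rw [h𝒢, h𝒢]
    exact biSup_mono fun i hi => Finset.Icc_subset_Icc_right hab hi
  have hadapt : ∀ i, 1 ≤ i → Measurable[𝒢 i] (X i) := fun i hi => by
    rw [measurable_iff_comap_le, h𝒢]
    exact le_iSup₂_of_le i (Finset.mem_Icc.2 ⟨hi, le_rfl⟩) le_rfl
  obtain ⟨hM, ⟨C, hC⟩, hint⟩ :=
    exp_sum_compensated_integral_le_one hl hXmeas hXbdd hle hmono hadapt n le_rfl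
  set M : Ω → ℝ := fun ω => Real.exp (∑ i ∈ Finset.Icc 1 n,
    (l * ((P[X i | 𝒢 (i - 1)]) ω - X i ω)
      - l ^ 2 / 2 * (P[fun ω' => X i ω' ^ 2 | 𝒢 (i - 1)]) ω)) with hMdef
  have hM0 : ∀ ω, 0 ≤ M ω := fun ω => (Real.exp_pos _).le
  have hMint : Integrable M P := by
    refine Integrable.of_bound (hM.mono (hle n)).aestronglyMeasurable C ?_
    filter_upwards [hC] with ω h
    rwa [Real.norm_of_nonneg (hM0 ω)]
  set c := l * ε - l ^ 2 / 2 * k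
  have hmarkov := (mul_meas_ge_le_integral_of_nonneg (Filter.Eventually.of_forall hM0) hMint
    (Real.exp c)).trans hint
  have hprob : P.real {ω | Real.exp c ≤ M ω} ≤ Real.exp (-c) := by
    rw [Real.exp_neg]
    exact (le_inv_mul_iff₀ (Real.exp_pos c)).2 hmarkov |>.trans_eq (mul_one _)
  calc
    _ ≤ P {ω | Real.exp c ≤ M ω} := by
      refine measure_mono fun ω ⟨h1, h2⟩ => Real.exp_le_exp.2 ?_
      rw [Finset.sum_sub_distrib, ← Finset.mul_sum, ← Finset.mul_sum, Finset.sum_sub_distrib]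
      exact sub_le_sub (mul_le_mul_of_nonneg_left h1 hl)
        (mul_le_mul_of_nonneg_left h2 (by positivity))
    _ = ENNReal.ofReal (P.real {ω | Real.exp c ≤ M ω}) := (ofReal_measureReal).symm
    _ ≤ _ := ENNReal.ofReal_le_ofReal
      (hprob.trans (Real.exp_le_exp.2 (freedman_exponent_le hε hk)))
end

section
/- Let d ≥ 1, σ > 0, B > 0, and μ₁, μ₂ ∈ ℝ^d with ‖μ₁‖₂ ≤ B and ‖μ₂‖₂ ≤ B. For i ∈ {1,2} let N_i : ℝ^d → ℝ be the Gaussian density N_i(z) = (2πσ²)^{−d/2} exp( −‖z − μ_i‖₂² / (2σ²) ). Let g : ℝ^d → ℝ be measurable with g ≥ 0 and ∫ g(z)² N₁(z) dz < ∞ (and g integrable against both N₁ and N₂). Then ∫ g(z) N₁(z) dz − ∫ g(z) N₂(z) dz ≤ exp( 2B²/σ² ) · ( ‖μ₁ − μ₂‖₂ / σ ) · √( ∫ g(z)² N₁(z) dz ). -/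
open MeasureTheory Real

/-- The **Cauchy–Schwarz inequality** for real integrals. -/
lemma integral_mul_le_sqrt_mul_sqrt {α : Type*} [MeasurableSpace α] {μ : Measure α}
    {u v : α → ℝ} (hu : Integrable (fun x => u x ^ 2) μ) (hv : Integrable (fun x => v x ^ 2) μ)
    (huv : Integrable (fun x => u x * v x) μ) :
    ∫ x, u x * v x ∂μ ≤ √(∫ x, u x ^ 2 ∂μ) * √(∫ x, v x ^ 2 ∂μ) := by
  have hquad (t : ℝ) : 0 ≤ (∫ x, u x ^ 2 ∂μ) * (t * t) + (2 * ∫ x, u x * v x ∂μ) * t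
      + ∫ x, v x ^ 2 ∂μ := by
    have hnonneg : 0 ≤ ∫ x, (t * u x + v x) ^ 2 ∂μ := integral_nonneg fun x => sq_nonneg _
    have hexpand : (fun x => (t * u x + v x) ^ 2) =
        fun x => (t * t) * u x ^ 2 + (2 * t) * (u x * v x) + v x ^ 2 := by
      funext x; ring
    have hint : Integrable (fun x => (t * t) * u x ^ 2 + (2 * t) * (u x * v x)) μ :=
      (hu.const_mul _).add (huv.const_mul _)
    rw [hexpand, integral_add hint hv,
      integral_add (hu.const_mul _) (huv.const_mul _), integral_const_mul,
      integral_const_mul] at hnonneg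
    linarith
  have hdiscrim := discrim_le_zero hquad
  rw [← Real.sqrt_mul (integral_nonneg fun x => sq_nonneg _)]
  apply Real.le_sqrt_of_sq_le
  rw [discrim] at hdiscrim
  linarith

/-- The isotropic Gaussian density with mean `m` and variance `σ ^ 2` has integral one. -/
lemma integral_isotropic_gaussian {d : ℕ} {σ : ℝ} (hσ : 0 < σ) (m : EuclideanSpace ℝ (Fin d)) :
    ∫ z, (2 * π * σ ^ 2) ^ (-(d : ℝ) / 2) * Real.exp (-‖z - m‖ ^ 2 / (2 * σ ^ 2)) = 1 := by
  have hpos : 0 < 2 * π * σ ^ 2 := by positivity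
  have hb : 0 < 1 / (2 * σ ^ 2) := by positivity
  rw [integral_const_mul, integral_sub_right_eq_self
    (fun z : EuclideanSpace ℝ (Fin d) => Real.exp (-‖z‖ ^ 2 / (2 * σ ^ 2)))]
  have hexp : (fun z : EuclideanSpace ℝ (Fin d) => Real.exp (-‖z‖ ^ 2 / (2 * σ ^ 2))) =
      fun z => Real.exp (-(1 / (2 * σ ^ 2)) * ‖z‖ ^ 2) := by
    funext z; congr 1; ring
  have hbase : π / (1 / (2 * σ ^ 2)) = 2 * π * σ ^ 2 := by
    rw [div_div_eq_mul_div, div_one]; ring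
  rw [hexp, GaussianFourier.integral_rexp_neg_mul_sq_norm hb, hbase, finrank_euclideanSpace_fin,
    ← Real.rpow_add hpos, neg_div, neg_add_cancel, Real.rpow_zero]

lemma integrable_isotropic_gaussian {d : ℕ} {σ : ℝ} (hσ : 0 < σ)
    (m : EuclideanSpace ℝ (Fin d)) :
    Integrable fun z => (2 * π * σ ^ 2) ^ (-(d : ℝ) / 2) *
      Real.exp (-‖z - m‖ ^ 2 / (2 * σ ^ 2)) :=
  .of_integral_ne_zero (by rw [integral_isotropic_gaussian hσ m]; exact one_ne_zero)

/-- Completing the square in the quotient of a squared Gaussian by another Gaussian. -/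
lemma gaussian_sq_eq {d : ℕ} {σ : ℝ} (hσ : 0 < σ) (m₁ m₂ z : EuclideanSpace ℝ (Fin d)) :
    Real.exp (-‖z - m₂‖ ^ 2 / (2 * σ ^ 2)) ^ 2 =
      Real.exp (‖m₁ - m₂‖ ^ 2 / σ ^ 2) *
        Real.exp (-‖z - ((2 : ℝ) • m₂ - m₁)‖ ^ 2 / (2 * σ ^ 2)) *
        Real.exp (-‖z - m₁‖ ^ 2 / (2 * σ ^ 2)) := by
  have hnorm : ‖z - ((2 : ℝ) • m₂ - m₁)‖ ^ 2 =
      2 * ‖z - m₂‖ ^ 2 - ‖z - m₁‖ ^ 2 + 2 * ‖m₁ - m₂‖ ^ 2 := by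
    have hsub : z - ((2 : ℝ) • m₂ - m₁) = (z - m₂) + (m₁ - m₂) := by
      rw [two_smul]; abel
    have hdiff : z - m₁ = (z - m₂) - (m₁ - m₂) := by abel
    rw [hsub, hdiff, norm_add_sq_real, norm_sub_sq_real (z - m₂) (m₁ - m₂)]
    ring
  rw [← Real.exp_nat_mul, ← Real.exp_add, ← Real.exp_add, hnorm]
  congr 1
  field_simp
  push_cast
  ring

lemma exp_sub_one_le_mul_exp (x : ℝ) : Real.exp x - 1 ≤ x * Real.exp x := by
  have h := mul_le_mul_of_nonneg_right (Real.add_one_le_exp (-x)) (Real.exp_pos x).le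
  rw [← Real.exp_add, neg_add_cancel, Real.exp_zero] at h
  linarith

open MeasureTheory Real

/-- **Expectation difference under two isotropic Gaussians (Lemma 31).**
With `‖μ₁‖, ‖μ₂‖ ≤ B` and `g ≥ 0` measurable and square-integrable against `N₁`,
`∫ g N₁ - ∫ g N₂ ≤ exp (2B²/σ²) (‖μ₁ - μ₂‖/σ) √(∫ g² N₁)`. -/
theorem expectation_difference_gaussians {d : ℕ} (hd : 1 ≤ d)
    (σ B : ℝ) (hσ : 0 < σ) (hB : 0 < B)
    (μ₁ μ₂ : EuclideanSpace ℝ (Fin d)) (hμ₁ : ‖μ₁‖ ≤ B) (hμ₂ : ‖μ₂‖ ≤ B)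
    (N₁ N₂ : EuclideanSpace ℝ (Fin d) → ℝ)
    (hN₁ : N₁ = fun z => (2 * π * σ ^ 2) ^ (-(d : ℝ) / 2) *
      Real.exp (-‖z - μ₁‖ ^ 2 / (2 * σ ^ 2)))
    (hN₂ : N₂ = fun z => (2 * π * σ ^ 2) ^ (-(d : ℝ) / 2) *
      Real.exp (-‖z - μ₂‖ ^ 2 / (2 * σ ^ 2)))
    (g : EuclideanSpace ℝ (Fin d) → ℝ) (hgmeas : Measurable g)
    (hgnonneg : ∀ z, 0 ≤ g z)
    (hgsq : Integrable (fun z => g z ^ 2 * N₁ z))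
    (hg₁ : Integrable (fun z => g z * N₁ z))
    (hg₂ : Integrable (fun z => g z * N₂ z)) :
    (∫ z, g z * N₁ z) - (∫ z, g z * N₂ z)
      ≤ Real.exp (2 * B ^ 2 / σ ^ 2) * (‖μ₁ - μ₂‖ / σ) *
        Real.sqrt (∫ z, g z ^ 2 * N₁ z) := by
  have hpos (z) : 0 < N₁ z := by rw [hN₁]; positivity
  have hint₁ : Integrable N₁ := hN₁ ▸ integrable_isotropic_gaussian hσ μ₁
  have hint₂ : Integrable N₂ := hN₂ ▸ integrable_isotropic_gaussian hσ μ₂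
  have hone₁ : ∫ z, N₁ z = 1 := hN₁ ▸ integral_isotropic_gaussian hσ μ₁
  have hone₂ : ∫ z, N₂ z = 1 := hN₂ ▸ integral_isotropic_gaussian hσ μ₂
  obtain ⟨N₃, hN₃⟩ : ∃ N₃ : EuclideanSpace ℝ (Fin d) → ℝ, N₃ = fun z =>
      (2 * π * σ ^ 2) ^ (-(d : ℝ) / 2) *
        Real.exp (-‖z - ((2 : ℝ) • μ₂ - μ₁)‖ ^ 2 / (2 * σ ^ 2)) := ⟨_, rfl⟩
  have hint₃ : Integrable N₃ := hN₃ ▸ integrable_isotropic_gaussian hσ _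
  have hone₃ : ∫ z, N₃ z = 1 := hN₃ ▸ integral_isotropic_gaussian hσ _
  set x := ‖μ₁ - μ₂‖ ^ 2 / σ ^ 2 with hx
  have hquot (z) : N₂ z ^ 2 = Real.exp x * N₃ z * N₁ z := by
    rw [hN₁, hN₂, hN₃]
    dsimp only
    rw [mul_pow, gaussian_sq_eq hσ μ₁ μ₂ z]
    ring
  have hu (z) : (g z * √(N₁ z)) ^ 2 = g z ^ 2 * N₁ z := by
    rw [mul_pow, Real.sq_sqrt (hpos z).le]
  have hv (z) : ((N₁ z - N₂ z) / √(N₁ z)) ^ 2 = N₁ z - 2 * N₂ z + Real.exp x * N₃ z := by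
    rw [div_pow, Real.sq_sqrt (hpos z).le, div_eq_iff (hpos z).ne']
    linear_combination hquot z
  have huv (z) : g z * √(N₁ z) * ((N₁ z - N₂ z) / √(N₁ z)) = g z * N₁ z - g z * N₂ z := by
    have hsqrt := (Real.sqrt_pos.2 (hpos z)).ne'
    field_simp
  have hint₁₂ : Integrable fun z => N₁ z - 2 * N₂ z := hint₁.sub (hint₂.const_mul 2)
  have hcs := integral_mul_le_sqrt_mul_sqrt (μ := volume)
    (u := fun z => g z * √(N₁ z)) (v := fun z => (N₁ z - N₂ z) / √(N₁ z))
    (by simpa only [hu] using hgsq)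
    (by simpa only [hv] using! hint₁₂.add (hint₃.const_mul _))
    (by simpa only [huv] using! hg₁.sub hg₂)
  have hchi : ∫ z, (N₁ z - 2 * N₂ z + Real.exp x * N₃ z) = Real.exp x - 1 := by
    rw [integral_add hint₁₂ (hint₃.const_mul _),
      integral_sub hint₁ (hint₂.const_mul 2), integral_const_mul, integral_const_mul,
      hone₁, hone₂, hone₃]
    ring
  simp only [hu, hv, huv] at hcs
  rw [integral_sub hg₁ hg₂, hchi] at hcs
  have hx_le : x ≤ 2 * (2 * B ^ 2 / σ ^ 2) := by
    have hdist : ‖μ₁ - μ₂‖ ≤ 2 * B := (norm_sub_le _ _).trans (by linarith)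
    calc x ≤ (2 * B) ^ 2 / σ ^ 2 := by rw [hx]; gcongr
      _ = 2 * (2 * B ^ 2 / σ ^ 2) := by ring
  have hsqrt : √(Real.exp x - 1) ≤ Real.exp (2 * B ^ 2 / σ ^ 2) * (‖μ₁ - μ₂‖ / σ) := by
    refine Real.sqrt_le_iff.2 ⟨by positivity, ?_⟩
    calc Real.exp x - 1 ≤ x * Real.exp x := exp_sub_one_le_mul_exp x
      _ ≤ x * Real.exp (2 * (2 * B ^ 2 / σ ^ 2)) := by gcongr
      _ = (Real.exp (2 * B ^ 2 / σ ^ 2) * (‖μ₁ - μ₂‖ / σ)) ^ 2 := by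
        rw [mul_pow, div_pow, ← Real.exp_nat_mul, hx, mul_comm]
        norm_cast
  calc (∫ z, g z * N₁ z) - ∫ z, g z * N₂ z
      ≤ √(∫ z, g z ^ 2 * N₁ z) * √(Real.exp x - 1) := hcs
    _ ≤ √(∫ z, g z ^ 2 * N₁ z) * (Real.exp (2 * B ^ 2 / σ ^ 2) * (‖μ₁ - μ₂‖ / σ)) := by gcongr
    _ = _ := mul_comm _ _
end

section
/- Let (S, 𝒮) be a measurable space with a σ-finite measure ν, let A be a nonempty finite set, d ≥ 1, t ≥ 1 a natural number, λ > 0, and B > 0. Let φ : S × A → ℝ^d and μ : S → ℝ^d be measurable with: (i) ‖φ(s,a)‖₂ ≤ 1 for all (s,a); (ii) for every (s,a), the function s' ↦ ⟨φ(s,a), μ(s')⟩ is nonnegative and integrates to 1 with respect to ν (a transition density); (iii) for every measurable g : S → ℝ with |g| ≤ 1, ‖ ∫_S μ(s) g(s) dν(s) ‖₂ ≤ √d. Let P and ρ be probability measures on S × A, let π : S → (A → [0,1]) be a measurable policy with Σ_{a ∈ A} π(a|s) = 1 for each s, and let H : S × A → ℝ be measurable with |H| ≤ B. Define the next-step law Q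 on S × A by Q(E) = ∫_{S×A} ∫_S Σ_{a' ∈ A} 1_E(s', a') π(a'|s') ⟨φ(s,a), μ(s')⟩ dν(s') dP(s,a), define ρ̂ on S × A by ρ̂(E) = (1/|A|) Σ_{a' ∈ A} ∫_{S×A} ∫_S 1_E(s', a') ⟨φ(s,a), μ(s')⟩ dν(s') dρ(s,a), and define the positive definite d×d matrix Σ = t · ∫_{S×A} φ(s,a) φ(s,a)ᵀ dρ(s,a) + λ I. Then ∫_{S×A} H dQ ≤ ( ∫_{S×A} √( φ(s,a)ᵀ Σ^{-1} φ(s,a) ) dP(s,a) ) · √( t |A| ∫_{S×A} H² dρ̂ + λ d B² ). -/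
open MeasureTheory Finset Matrix

theorem Matrix.PosDef.dotProduct_le_sqrt_mul_sqrt {n : Type*} [Fintype n] [DecidableEq n]
    {M : Matrix n n ℝ} (hM : M.PosDef) (v w : n → ℝ) :
    v ⬝ᵥ w ≤ √(v ⬝ᵥ (M⁻¹ *ᵥ v)) * √(w ⬝ᵥ (M *ᵥ w)) := by
  have hdet : IsUnit M.det := (Matrix.isUnit_iff_isUnit_det M).mp hM.isUnit
  have hsymm : Mᵀ = M := by simpa using hM.isHermitian.eq
  set u := M⁻¹ *ᵥ v with hu
  have hMu : M *ᵥ u = v := by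
    rw [hu, Matrix.mulVec_mulVec, Matrix.mul_nonsing_inv _ hdet, Matrix.one_mulVec]
  have huMw : u ⬝ᵥ (M *ᵥ w) = v ⬝ᵥ w := by
    rw [Matrix.dotProduct_mulVec, ← Matrix.mulVec_transpose, hsymm, hMu]
  have hquad (s : ℝ) : 0 ≤ (v ⬝ᵥ u) * (s * s) + (-2 * (v ⬝ᵥ w)) * s + w ⬝ᵥ (M *ᵥ w) := by
    have h := hM.posSemidef.dotProduct_mulVec_nonneg (w - s • u)
    simp only [star_trivial, Matrix.mulVec_sub, Matrix.mulVec_smul, hMu, sub_dotProduct,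
      dotProduct_sub, smul_dotProduct, dotProduct_smul, huMw, smul_eq_mul,
      dotProduct_comm w v, dotProduct_comm u v] at h
    linarith
  have hdisc := discrim_le_zero hquad
  rw [discrim] at hdisc
  have hvu : 0 ≤ v ⬝ᵥ u := by
    have h := hM.posSemidef.dotProduct_mulVec_nonneg u
    simpa [hMu, dotProduct_comm u v] using h
  rw [← Real.sqrt_mul hvu]
  apply Real.le_sqrt_of_sq_le
  linarith

theorem MeasureTheory.sq_integral_mul_le_integral_sq_mul {α : Type*} [MeasurableSpace α]
    {ν : Measure α} {f p : α → ℝ} (hp : ∀ s, 0 ≤ p s) (hp_one : ∫ s, p s ∂ν = 1)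
    (hp_int : Integrable p ν) (hf : Integrable (fun s => f s * p s) ν)
    (hf_sq : Integrable (fun s => f s ^ 2 * p s) ν) :
    (∫ s, f s * p s ∂ν) ^ 2 ≤ ∫ s, f s ^ 2 * p s ∂ν := by
  set c := ∫ s, f s * p s ∂ν with hc
  have h : 0 ≤ ∫ s, (f s - c) ^ 2 * p s ∂ν :=
    integral_nonneg fun s => mul_nonneg (sq_nonneg _) (hp s)
  have heq : ∫ s, (f s - c) ^ 2 * p s ∂ν = ∫ s, f s ^ 2 * p s ∂ν - 2 * c * c + c ^ 2 := by
    have hexp : (fun s => (f s - c) ^ 2 * p s)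
        = fun s => f s ^ 2 * p s - 2 * c * (f s * p s) + c ^ 2 * p s := by
      funext s; ring
    have hdiff : Integrable (fun s => f s ^ 2 * p s - 2 * c * (f s * p s)) ν :=
      hf_sq.sub (hf.const_mul _)
    rw [hexp, integral_add hdiff (hp_int.const_mul _),
      integral_sub hf_sq (hf.const_mul _), integral_const_mul, integral_const_mul, hp_one, mul_one]
  rw [heq] at h
  linarith

theorem MeasureTheory.Integrable.mul_of_abs_le {α : Type*} [MeasurableSpace α]
    {ν : Measure α} {f p : α → ℝ} {C : ℝ} (hp : Integrable p ν) (hf : Measurable f)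
    (hfC : ∀ s, |f s| ≤ C) : Integrable (fun s => f s * p s) ν :=
  hp.bdd_mul hf.aestronglyMeasurable (Filter.Eventually.of_forall hfC)

theorem MeasureTheory.abs_integral_mul_le_of_abs_le {α : Type*} [MeasurableSpace α]
    {ν : Measure α} {f p : α → ℝ} {C : ℝ} (hp : ∀ s, 0 ≤ p s) (hp_one : ∫ s, p s ∂ν = 1)
    (hfC : ∀ s, |f s| ≤ C) : |∫ s, f s * p s ∂ν| ≤ C := by
  have hp_int : Integrable p ν := .of_integral_ne_zero (by simp [hp_one])
  have hle (s : α) : ‖f s * p s‖ ≤ C * p s := by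
    rw [norm_mul, Real.norm_of_nonneg (hp s)]
    exact mul_le_mul_of_nonneg_right (hfC s) (hp s)
  calc |∫ s, f s * p s ∂ν| ≤ ∫ s, C * p s ∂ν :=
        norm_integral_le_of_norm_le (hp_int.const_mul C) (.of_forall hle)
    _ = C := by rw [integral_const_mul, hp_one, mul_one]

theorem MeasureTheory.integrable_integral_mul_of_abs_le {α β : Type*} [MeasurableSpace α]
    [MeasurableSpace β] {ν : Measure α} [SFinite ν] {κ : Measure β} [IsFiniteMeasure κ]
    {f : α → ℝ} {p : β → α → ℝ} {C : ℝ} (hp_meas : Measurable (Function.uncurry p))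
    (hp : ∀ x s, 0 ≤ p x s) (hp_one : ∀ x, ∫ s, p x s ∂ν = 1) (hf : Measurable f)
    (hfC : ∀ s, |f s| ≤ C) : Integrable (fun x => ∫ s, f s * p x s ∂ν) κ := by
  have hmeas : StronglyMeasurable fun z : β × α => f z.2 * p z.1 z.2 :=
    ((hf.comp measurable_snd).mul hp_meas).stronglyMeasurable
  exact .of_bound hmeas.integral_prod_right'.aestronglyMeasurable C
    (.of_forall fun x => abs_integral_mul_le_of_abs_le (hp x) (hp_one x) hfC)

theorem abs_le_one_of_sqrt_sum_sq_le_one {n : Type*} [Fintype n] {v : n → ℝ}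
    (hv : √(∑ i, v i ^ 2) ≤ 1) (i : n) : |v i| ≤ 1 := by
  have h : √(v i ^ 2) ≤ √(∑ i, v i ^ 2) :=
    Real.sqrt_le_sqrt (Finset.single_le_sum (fun j _ => sq_nonneg (v j)) (Finset.mem_univ i))
  rw [Real.sqrt_sq_eq_abs] at h
  exact h.trans hv

theorem dotProduct_regularizedCovariance_mulVec {α n : Type*} [MeasurableSpace α] [Fintype n]
    [DecidableEq n] {κ : Measure α} {φ : α → n → ℝ}
    (hφ : ∀ i j, Integrable (fun x => φ x i * φ x j) κ) (t lam : ℝ) (w : n → ℝ) :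
    w ⬝ᵥ ((t • Matrix.of (fun i j => ∫ x, φ x i * φ x j ∂κ) + lam • (1 : Matrix n n ℝ)) *ᵥ w)
      = t * ∫ x, (∑ i, φ x i * w i) ^ 2 ∂κ + lam * ∑ i, w i ^ 2 := by
  have hsq : ∫ x, (∑ i, φ x i * w i) ^ 2 ∂κ
      = ∑ i, ∑ j, w i * ((∫ x, φ x i * φ x j ∂κ) * w j) := by
    have hexp : (fun x => (∑ i, φ x i * w i) ^ 2)
        = fun x => ∑ i, ∑ j, (w i * w j) * (φ x i * φ x j) := by
      funext x
      rw [sq, Finset.sum_mul_sum]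
      exact Finset.sum_congr rfl fun i _ => Finset.sum_congr rfl fun j _ => by ring
    rw [hexp, integral_finsetSum _ fun i _ => integrable_finsetSum _ fun j _ =>
      (hφ i j).const_mul _]
    refine Finset.sum_congr rfl fun i _ => ?_
    rw [integral_finsetSum _ fun j _ => (hφ i j).const_mul _]
    refine Finset.sum_congr rfl fun j _ => ?_
    rw [integral_const_mul]
    ring
  rw [Matrix.add_mulVec, Matrix.smul_mulVec, Matrix.smul_mulVec, Matrix.one_mulVec,
    dotProduct_add, dotProduct_smul, dotProduct_smul, hsq]
  simp only [dotProduct, Matrix.mulVec, Matrix.of_apply, smul_eq_mul, Finset.mul_sum, sq]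

theorem posDef_regularizedCovariance {α n : Type*} [MeasurableSpace α] [Fintype n]
    [DecidableEq n] {κ : Measure α} {φ : α → n → ℝ}
    (hφ : ∀ i j, Integrable (fun x => φ x i * φ x j) κ) {t lam : ℝ} (ht : 0 ≤ t)
    (hlam : 0 < lam) :
    (t • Matrix.of (fun i j => ∫ x, φ x i * φ x j ∂κ) + lam • (1 : Matrix n n ℝ)).PosDef := by
  refine .of_dotProduct_mulVec_pos ?_ fun w hw => ?_
  · ext i j
    simp [Matrix.one_apply, mul_comm (φ _ i), eq_comm]
  · rw [star_trivial, dotProduct_regularizedCovariance_mulVec hφ]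
    have h_sum : 0 < ∑ i, w i ^ 2 := by
      obtain ⟨i, hi⟩ := Function.ne_iff.mp hw
      exact Finset.sum_pos' (fun j _ => sq_nonneg _) ⟨i, Finset.mem_univ i, by
        have : w i ≠ 0 := hi
        positivity⟩
    have h_int : 0 ≤ ∫ x, (∑ i, φ x i * w i) ^ 2 ∂κ := integral_nonneg fun x => sq_nonneg _
    positivity

/-- Integrability of each coordinate of `μ` is not assumed: `g` is truncated to sets on which
all coordinates of `μ` are bounded, and the bound passes to the limit. -/
theorem integral_mul_density_le {S X n : Type*} [MeasurableSpace S] [MeasurableSpace X]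
    [Fintype n] [DecidableEq n] {ν : Measure S} [SigmaFinite ν] {φ : X → n → ℝ} {μ : S → n → ℝ}
    (hφ : Measurable φ) (hφ_le : ∀ x, √(∑ i, φ x i ^ 2) ≤ 1) (hμ : Measurable μ)
    (hp : ∀ x s, 0 ≤ ∑ i, φ x i * μ s i) (hp_one : ∀ x, ∫ s, ∑ i, φ x i * μ s i ∂ν = 1)
    {D : ℝ} (hμ_norm : ∀ g : S → ℝ, Measurable g → (∀ s, |g s| ≤ 1) →
      √(∑ i, (∫ s, μ s i * g s ∂ν) ^ 2) ≤ √D)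
    {κ : Measure X} [IsProbabilityMeasure κ] {t lam B : ℝ} (ht : 0 ≤ t) (hlam : 0 < lam)
    (hB : 0 < B) (hD : 0 ≤ D) {g : S → ℝ} (hg : Measurable g) (hgB : ∀ s, |g s| ≤ B)
    {M : Matrix n n ℝ}
    (hM : M = t • Matrix.of (fun i j => ∫ x, φ x i * φ x j ∂κ) + lam • (1 : Matrix n n ℝ))
    (x : X) :
    ∫ s, g s * ∑ i, φ x i * μ s i ∂ν ≤ √(φ x ⬝ᵥ (M⁻¹ *ᵥ φ x)) *
      √(t * (∫ y, ∫ s, g s ^ 2 * ∑ i, φ y i * μ s i ∂ν ∂κ) + lam * D * B ^ 2) := by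
  have hφ_abs (y : X) (i : n) : |φ y i| ≤ 1 := abs_le_one_of_sqrt_sum_sq_le_one (hφ_le y) i
  have hφ_coord (i : n) : Measurable fun y => φ y i := (measurable_pi_apply i).comp hφ
  have hμ_coord (i : n) : Measurable fun s => μ s i := (measurable_pi_apply i).comp hμ
  have hφφ (i j : n) : Integrable (fun y => φ y i * φ y j) κ :=
    .of_bound ((hφ_coord i).mul (hφ_coord j)).aestronglyMeasurable 1 <| .of_forall fun y => by
      rw [Real.norm_eq_abs, abs_mul]
      exact mul_le_one₀ (hφ_abs y i) (abs_nonneg _) (hφ_abs y j)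
  have hp_meas : Measurable (Function.uncurry fun y s => ∑ i, φ y i * μ s i) :=
    Finset.measurable_sum _ fun i _ =>
      ((hφ_coord i).comp measurable_fst).mul ((hμ_coord i).comp measurable_snd)
  have hp_int (y : X) : Integrable (fun s => ∑ i, φ y i * μ s i) ν :=
    .of_integral_ne_zero (by simp [hp_one])
  have hPD : M.PosDef := hM ▸ posDef_regularizedCovariance hφφ ht hlam
  have hg_sq (s : S) : |g s ^ 2| ≤ B ^ 2 := by
    rw [abs_pow]
    exact pow_le_pow_left₀ (abs_nonneg _) (hgB s) 2
  let E (k : ℕ) : Set S := spanningSets ν k ∩ ⋂ i, {s | |μ s i| ≤ k}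
  have hE (k : ℕ) : MeasurableSet (E k) :=
    (measurableSet_spanningSets ν k).inter <| .iInter fun i =>
      measurableSet_le (hμ_coord i).abs measurable_const
  let G (k : ℕ) : S → ℝ := (E k).indicator g
  have hG (k : ℕ) : Measurable (G k) := hg.indicator (hE k)
  have hG_le (k : ℕ) (s : S) : |G k s| ≤ |g s| := by
    by_cases hs : s ∈ E k <;> simp [G, hs]
  have hGB (k : ℕ) (s : S) : |G k s| ≤ B := (hG_le k s).trans (hgB s)
  have hG_sq (k : ℕ) (s : S) : G k s ^ 2 ≤ g s ^ 2 := sq_le_sq.mpr (hG_le k s)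
  have hμG (k : ℕ) (i : n) : Integrable (fun s => μ s i * G k s) ν := by
    have hon : IntegrableOn (fun s => μ s i * g s) (E k) ν := by
      refine .of_bound ((measure_mono Set.inter_subset_left).trans_lt
        (measure_spanningSets_lt_top ν k)) ((hμ_coord i).mul hg).aestronglyMeasurable (k * B) ?_
      refine ae_restrict_of_forall_mem (hE k) fun s hs => ?_
      rw [Real.norm_eq_abs, abs_mul]
      exact mul_le_mul (Set.mem_iInter.mp hs.2 i) (hgB s) (abs_nonneg _) (Nat.cast_nonneg k)
    refine (hon.integrable_indicator (hE k)).congr (.of_forall fun s => ?_)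
    by_cases hs : s ∈ E k <;> simp [G, hs]
  let W (k : ℕ) : n → ℝ := fun i => ∫ s, μ s i * G k s ∂ν
  have hW (k : ℕ) (y : X) : ∑ i, φ y i * W k i = ∫ s, G k s * ∑ i, φ y i * μ s i ∂ν := by
    simp only [W, ← integral_const_mul]
    rw [← integral_finsetSum _ fun i _ => (hμG k i).const_mul _]
    refine integral_congr_ae (.of_forall fun s => ?_)
    simp only [Finset.mul_sum]
    exact Finset.sum_congr rfl fun i _ => by ring
  have hW_norm (k : ℕ) : ∑ i, W k i ^ 2 ≤ D * B ^ 2 := by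
    have h := hμ_norm (fun s => G k s / B) ((hG k).div_const B) fun s => by
      rw [abs_div, abs_of_pos hB]
      exact (div_le_one hB).mpr (hGB k s)
    rw [Real.sqrt_le_sqrt_iff hD] at h
    simp only [← mul_div_assoc, integral_div, div_pow] at h
    rwa [← Finset.sum_div, div_le_iff₀ (by positivity)] at h
  have hW_sq (k : ℕ) (y : X) :
      (∑ i, φ y i * W k i) ^ 2 ≤ ∫ s, g s ^ 2 * ∑ i, φ y i * μ s i ∂ν := by
    have hGsq_int : Integrable (fun s => G k s ^ 2 * ∑ i, φ y i * μ s i) ν :=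
      (hp_int y).mul_of_abs_le ((hG k).pow_const 2) fun s =>
        (abs_of_nonneg (sq_nonneg (G k s))).trans_le ((hG_sq k s).trans
          ((le_abs_self _).trans (hg_sq s)))
    rw [hW]
    refine (sq_integral_mul_le_integral_sq_mul (hp y) (hp_one y) (hp_int y)
      ((hp_int y).mul_of_abs_le (hG k) (hGB k)) hGsq_int).trans ?_
    exact integral_mono hGsq_int ((hp_int y).mul_of_abs_le (hg.pow_const 2) hg_sq) fun s =>
      mul_le_mul_of_nonneg_right (hG_sq k s) (hp y s)
  have hbound (k : ℕ) : ∫ s, G k s * ∑ i, φ x i * μ s i ∂ν ≤ √(φ x ⬝ᵥ (M⁻¹ *ᵥ φ x)) *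
      √(t * (∫ y, ∫ s, g s ^ 2 * ∑ i, φ y i * μ s i ∂ν ∂κ) + lam * D * B ^ 2) := by
    rw [← hW]
    refine (hPD.dotProduct_le_sqrt_mul_sqrt (φ x) (W k)).trans ?_
    refine mul_le_mul_of_nonneg_left (Real.sqrt_le_sqrt ?_) (Real.sqrt_nonneg _)
    rw [hM, dotProduct_regularizedCovariance_mulVec hφφ, mul_assoc lam]
    refine add_le_add (mul_le_mul_of_nonneg_left ?_ ht)
      (mul_le_mul_of_nonneg_left (hW_norm k) hlam.le)
    exact integral_mono_of_nonneg (.of_forall fun y => sq_nonneg _)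
      (integrable_integral_mul_of_abs_le hp_meas hp hp_one (hg.pow_const 2) hg_sq)
      (.of_forall (hW_sq k))
  refine le_of_tendsto' (tendsto_integral_of_dominated_convergence
    (fun s => B * ∑ i, φ x i * μ s i)
    (fun k => ((hp_int x).mul_of_abs_le (hG k) (hGB k)).aestronglyMeasurable)
    ((hp_int x).const_mul B) (fun k => .of_forall fun s => ?_) (.of_forall fun s => ?_)) hbound
  · rw [Real.norm_eq_abs, abs_mul, abs_of_nonneg (hp x s)]
    exact mul_le_mul_of_nonneg_right (hGB k s) (hp x s)
  · refine tendsto_const_nhds.congr' ?_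
    obtain ⟨m, hm⟩ := exists_nat_ge (∑ i, |μ s i|)
    filter_upwards [Filter.eventually_ge_atTop (max m (spanningSetsIndex ν s))] with k hk
    have hs : s ∈ E k := by
      refine ⟨mem_spanningSets_of_index_le ν s ((le_max_right _ _).trans hk),
        Set.mem_iInter.mpr fun i => ?_⟩
      calc |μ s i| ≤ ∑ i, |μ s i| :=
            Finset.single_le_sum (fun j _ => abs_nonneg (μ s j)) (Finset.mem_univ i)
        _ ≤ m := hm
        _ ≤ k := by exact_mod_cast (le_max_left _ _).trans hk
    simp [G, hs]

theorem integrable_sqrt_dotProduct_mulVec {α n : Type*} [MeasurableSpace α] [Fintype n]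
    {κ : Measure α} [IsFiniteMeasure κ] {φ : α → n → ℝ} (hφ : Measurable φ)
    (hφ_abs : ∀ x i, |φ x i| ≤ 1) (M : Matrix n n ℝ) :
    Integrable (fun x => √(φ x ⬝ᵥ (M *ᵥ φ x))) κ := by
  have hφ_coord (i : n) : Measurable fun y => φ y i := (measurable_pi_apply i).comp hφ
  have hmeas : Measurable fun x => φ x ⬝ᵥ (M *ᵥ φ x) := by
    simp only [dotProduct, Matrix.mulVec]
    fun_prop
  refine .of_bound hmeas.sqrt.aestronglyMeasurable (√(∑ i, ∑ j, |M i j|)) (.of_forall fun x => ?_)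
  rw [Real.norm_eq_abs, abs_of_nonneg (Real.sqrt_nonneg _)]
  refine Real.sqrt_le_sqrt ?_
  simp only [dotProduct, Matrix.mulVec, Finset.mul_sum]
  refine Finset.sum_le_sum fun i _ => Finset.sum_le_sum fun j _ => (le_abs_self _).trans ?_
  rw [abs_mul, abs_mul]
  calc |φ x i| * (|M i j| * |φ x j|) ≤ 1 * (|M i j| * 1) :=
        mul_le_mul (hφ_abs x i) (mul_le_mul_of_nonneg_left (hφ_abs x j) (abs_nonneg _))
          (by positivity) zero_le_one
    _ = |M i j| := by ring

theorem abs_sum_mul_le_of_abs_le {A : Type*} [Fintype A] {h q : A → ℝ} {B : ℝ}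
    (hh : ∀ a, |h a| ≤ B) (hq : ∀ a, 0 ≤ q a) (hq_sum : ∑ a, q a = 1) :
    |∑ a, h a * q a| ≤ B := by
  calc |∑ a, h a * q a| ≤ ∑ a, |h a * q a| := Finset.abs_sum_le_sum_abs _ _
    _ ≤ ∑ a, B * q a := Finset.sum_le_sum fun a _ => by
        rw [abs_mul, abs_of_nonneg (hq a)]
        exact mul_le_mul_of_nonneg_right (hh a) (hq a)
    _ = B := by rw [← Finset.mul_sum, hq_sum, mul_one]

theorem sq_sum_mul_le_sum_sq {A : Type*} [Fintype A] {h q : A → ℝ} (hq : ∀ a, 0 ≤ q a)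
    (hq_le : ∀ a, q a ≤ 1) (hq_sum : ∑ a, q a = 1) :
    (∑ a, h a * q a) ^ 2 ≤ ∑ a, h a ^ 2 := by
  have hq_sq : ∑ a, q a ^ 2 ≤ 1 := hq_sum ▸ Finset.sum_le_sum fun a _ => by
    nlinarith [hq a, hq_le a]
  exact (Finset.sum_mul_sq_le_sq_mul_sq _ h q).trans
    (mul_le_of_le_one_right (Finset.sum_nonneg fun a _ => sq_nonneg _) hq_sq)

/-- **One-step-back inequality for low-rank transition models (Lemma 14).**
The transition from `(s,a)` to `s'` has density `⟨φ (s,a), μ s'⟩` w.r.t. `ν`;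
`P` is the law of the previous state-action pair, `Q` the law of the next
state-action pair when the next action is drawn from the policy `π`, `ρ̂`
replaces the policy by the uniform distribution over actions (with data
distribution `ρ`), and `Σ = t ∫ φ φᵀ dρ + λ I`.  Then
`∫ H dQ ≤ (∫ √(φᵀ Σ⁻¹ φ) dP) · √(t |A| ∫ H² dρ̂ + λ d B²)`,
with `∫ H dQ` and `∫ H² dρ̂` written out via the defining formulas of `Q`, `ρ̂`. -/
theorem one_step_back_inequality
    {S : Type*} [MeasurableSpace S] (ν : Measure S) [SigmaFinite ν]
    {A : Type*} [Fintype A] [Nonempty A] [MeasurableSpace A]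
    {d : ℕ} (hd : 1 ≤ d) (t : ℕ) (ht : 1 ≤ t) (lam B : ℝ)
    (hlam : 0 < lam) (hB : 0 < B)
    (φ : S × A → Fin d → ℝ) (hφmeas : Measurable φ)
    (hφbdd : ∀ x : S × A, Real.sqrt (∑ i, φ x i ^ 2) ≤ 1)
    (μ : S → Fin d → ℝ) (hμmeas : Measurable μ)
    (hdens_nonneg : ∀ x : S × A, ∀ s' : S, 0 ≤ ∑ i, φ x i * μ s' i)
    (hdens_int : ∀ x : S × A, (∫ s', ∑ i, φ x i * μ s' i ∂ν) = 1)
    (hμnorm : ∀ g : S → ℝ, Measurable g → (∀ s, |g s| ≤ 1) →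
      Real.sqrt (∑ i, (∫ s, μ s i * g s ∂ν) ^ 2) ≤ Real.sqrt d)
    (P ρ : Measure (S × A)) [IsProbabilityMeasure P] [IsProbabilityMeasure ρ]
    (π : S → A → ℝ) (hπmeas : ∀ a, Measurable (fun s => π s a))
    (hπnonneg : ∀ s a, 0 ≤ π s a) (hπle : ∀ s a, π s a ≤ 1)
    (hπsum : ∀ s, ∑ a, π s a = 1)
    (H : S × A → ℝ) (hHmeas : Measurable H) (hHbdd : ∀ x, |H x| ≤ B)
    (Sig : Matrix (Fin d) (Fin d) ℝ)
    (hSig : Sig = (t : ℝ) • Matrix.of (fun i j => ∫ x, φ x i * φ x j ∂ρ)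
      + lam • (1 : Matrix (Fin d) (Fin d) ℝ)) :
    (∫ x, (∫ s', ∑ a', H (s', a') * π s' a' * (∑ i, φ x i * μ s' i) ∂ν) ∂P)
      ≤ (∫ x, Real.sqrt (φ x ⬝ᵥ (Sig⁻¹.mulVec (φ x))) ∂P) *
        Real.sqrt ((t : ℝ) * (Fintype.card A) *
            ((1 / (Fintype.card A : ℝ)) * ∑ a',
              ∫ x, (∫ s', H (s', a') ^ 2 * (∑ i, φ x i * μ s' i) ∂ν) ∂ρ)
          + lam * d * B ^ 2) := by
  classical
  set g : S → ℝ := fun s => ∑ a, H (s, a) * π s a with hg_def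
  have hH_sec (a : A) : Measurable fun s => H (s, a) :=
    hHmeas.comp (measurable_id.prodMk measurable_const)
  have hg : Measurable g := Finset.measurable_sum _ fun a _ => (hH_sec a).mul (hπmeas a)
  have hgB (s : S) : |g s| ≤ B :=
    abs_sum_mul_le_of_abs_le (fun a => hHbdd (s, a)) (hπnonneg s) (hπsum s)
  have hH_sq (a : A) (s : S) : |H (s, a) ^ 2| ≤ B ^ 2 := by
    rw [abs_pow]
    exact pow_le_pow_left₀ (abs_nonneg _) (hHbdd _) 2
  have hg_sq (s : S) : |g s ^ 2| ≤ B ^ 2 := by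
    rw [abs_pow]
    exact pow_le_pow_left₀ (abs_nonneg _) (hgB s) 2
  have hp_meas : Measurable (Function.uncurry fun x s => ∑ i, φ x i * μ s i) :=
    Finset.measurable_sum _ fun i _ =>
      (((measurable_pi_apply i).comp hφmeas).comp measurable_fst).mul
        (((measurable_pi_apply i).comp hμmeas).comp measurable_snd)
  have hp_int (x : S × A) : Integrable (fun s => ∑ i, φ x i * μ s i) ν :=
    .of_integral_ne_zero (by simp [hdens_int])
  have hcard : (Fintype.card A : ℝ) ≠ 0 := Nat.cast_ne_zero.mpr Fintype.card_ne_zero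
  have hHH (a : A) : Integrable
      (fun x => ∫ s, H (s, a) ^ 2 * ∑ i, φ x i * μ s i ∂ν) ρ :=
    integrable_integral_mul_of_abs_le hp_meas hdens_nonneg hdens_int ((hH_sec a).pow_const 2)
      (hH_sq a)
  have hsecond : ∫ x, ∫ s, g s ^ 2 * ∑ i, φ x i * μ s i ∂ν ∂ρ
      ≤ ∑ a, ∫ x, ∫ s, H (s, a) ^ 2 * ∑ i, φ x i * μ s i ∂ν ∂ρ := by
    rw [← integral_finsetSum _ fun a _ => hHH a]
    refine integral_mono (integrable_integral_mul_of_abs_le hp_meas hdens_nonneg hdens_int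
      (hg.pow_const 2) hg_sq) (integrable_finsetSum _ fun a _ => hHH a) fun x => ?_
    have hHx (a : A) : Integrable (fun s => H (s, a) ^ 2 * ∑ i, φ x i * μ s i) ν :=
      (hp_int x).mul_of_abs_le ((hH_sec a).pow_const 2) (hH_sq a)
    beta_reduce
    rw [← integral_finsetSum _ fun a _ => hHx a]
    refine integral_mono ((hp_int x).mul_of_abs_le (hg.pow_const 2) hg_sq)
      (integrable_finsetSum _ fun a _ => hHx a) fun s => ?_
    beta_reduce
    rw [← Finset.sum_mul]
    exact mul_le_mul_of_nonneg_right
      (sq_sum_mul_le_sum_sq (hπnonneg s) (hπle s) (hπsum s)) (hdens_nonneg x s)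
  have hscale (c : ℝ) :
      (t : ℝ) * Fintype.card A * (1 / (Fintype.card A : ℝ) * c) = t * c := by
    field_simp
  simp only [← Finset.sum_mul]
  rw [hscale, ← integral_mul_const]
  refine integral_mono
    (integrable_integral_mul_of_abs_le hp_meas hdens_nonneg hdens_int hg hgB)
    ((integrable_sqrt_dotProduct_mulVec hφmeas
      (fun x => abs_le_one_of_sqrt_sum_sq_le_one (hφbdd x)) _).mul_const _) fun x => ?_
  refine (integral_mul_density_le hφmeas hφbdd hμmeas hdens_nonneg hdens_int hμnorm
    (Nat.cast_nonneg t) hlam hB (Nat.cast_nonneg d) hg hgB hSig x).trans ?_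
  gcongr
end
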